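/- arXiv:2410.08898 — 3 statements merged into one kernel-verified Lean document; each statement's English description precedes it below -/
import Mathlib

section
/- Let f : {-1,1}^N → ℝ be a function with f̂(T) ≠ 0 for some T ⊆ [N] with T ⊄ [N0]. Then every min-degree interpolator g of f on X_{N0} fails to agree with f on all of {-1,1}^N; that is, there exists x ∈ {-1,1}^N with g(x) ≠ f(x). -/
open Finset

noncomputable section

/-- The point of the Boolean cube `{-1,1}^N ⊆ ℝ^N` encoded by a sign pattern. -/
def toVec {N : ℕ} (σ : Fin N → Bool) : Fin N → ℝ := fun i => if σ i then 1 else -1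

/-- The Fourier coefficient `f̂(T) = 2^{-N} ∑_{x ∈ {-1,1}^N} f(x) ∏_{i ∈ T} x_i`. -/
def fCoeff {N : ℕ} (f : (Fin N → ℝ) → ℝ) (T : Finset (Fin N)) : ℝ :=
  (∑ σ : Fin N → Bool, f (toVec σ) * ∏ i ∈ T, toVec σ i) / 2 ^ N

/-- The degree profile: the `(N+1)`-tuple whose entry at (0-based) index `i` is
`∑_{|T| = N - i} f̂(T)²`. -/
def degP (N : ℕ) (f : (Fin N → ℝ) → ℝ) : Fin (N + 1) → ℝ :=
  fun i => ∑ T ∈ Finset.univ.filter (fun T : Finset (Fin N) => T.card = N - (i : ℕ)),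
    fCoeff f T ^ 2

/-- Strict lexicographic order on tuples. -/
def lexLt {n : ℕ} (a b : Fin n → ℝ) : Prop :=
  ∃ i, (∀ j, j < i → a j = b j) ∧ a i < b i

/-- Lexicographic order on tuples. -/
def lexLe {n : ℕ} (a b : Fin n → ℝ) : Prop := a = b ∨ lexLt a b

/-- `g` interpolates `f` on `X_{N0} = {x ∈ {-1,1}^N : x_i = 1 for all i > N0}`. -/
def Interpolates (N N0 : ℕ) (g f : (Fin N → ℝ) → ℝ) : Prop :=
  ∀ σ : Fin N → Bool, (∀ i : Fin N, N0 ≤ (i : ℕ) → σ i = true) → g (toVec σ) = f (toVec σ)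

/-- `g` is a min-degree interpolator of `f` on `X_{N0}`. -/
def MinDegInterpolator (N N0 : ℕ) (g f : (Fin N → ℝ) → ℝ) : Prop :=
  Interpolates N N0 g f ∧
    ∀ g' : (Fin N → ℝ) → ℝ, Interpolates N N0 g' f → lexLe (degP N g) (degP N g')


/-- The multilinear monomial `∏_{i ∈ S} x_i`. -/
def monomialOn {N : ℕ} (S : Finset (Fin N)) : (Fin N → ℝ) → ℝ := fun x => ∏ i ∈ S, x i

lemma fCoeff_congr {N : ℕ} {f g : (Fin N → ℝ) → ℝ}
    (h : ∀ σ : Fin N → Bool, g (toVec σ) = f (toVec σ)) (T : Finset (Fin N)) :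
    fCoeff g T = fCoeff f T := by
  simp only [fCoeff, h]

lemma fCoeff_add_mul_sub {N : ℕ} (f p q : (Fin N → ℝ) → ℝ) (t : ℝ) (T : Finset (Fin N)) :
    fCoeff (fun x => f x + t * (p x - q x)) T
      = fCoeff f T + t * (fCoeff p T - fCoeff q T) := by
  simp only [fCoeff, add_mul, mul_assoc, sub_mul, Finset.sum_add_distrib, ← Finset.mul_sum,
    Finset.sum_sub_distrib]
  ring

/-- Orthonormality of the monomials on the Boolean cube. -/
lemma fCoeff_monomialOn {N : ℕ} (S T : Finset (Fin N)) :
    fCoeff (monomialOn S) T = if S = T then 1 else 0 := by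
  have key : (∑ σ : Fin N → Bool, (∏ i ∈ S, toVec σ i) * ∏ i ∈ T, toVec σ i)
      = ∏ i : Fin N, ∑ b : Bool, (if i ∈ S then (if b then (1 : ℝ) else -1) else 1)
          * (if i ∈ T then (if b then (1 : ℝ) else -1) else 1) := by
    rw [Finset.prod_univ_sum, Fintype.piFinset_univ]
    refine Finset.sum_congr rfl fun σ _ => ?_
    rw [Finset.prod_mul_distrib]
    simp [Finset.prod_ite_mem, toVec]
  simp only [fCoeff, monomialOn, key]
  split_ifs with h
  · subst h
    have : ∀ i : Fin N, ∑ b : Bool, (if i ∈ S then (if b then (1 : ℝ) else -1) else 1)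
          * (if i ∈ S then (if b then (1 : ℝ) else -1) else 1) = 2 := by
      intro i
      by_cases hi : i ∈ S <;> simp [hi] <;> norm_num
    rw [Finset.prod_congr rfl fun i _ => this i]
    simp
  · obtain ⟨i, hi⟩ : ∃ i, ¬ (i ∈ S ↔ i ∈ T) := by
      by_contra! hc
      exact h (Finset.ext hc)
    rw [Finset.prod_eq_zero (Finset.mem_univ i), zero_div]
    by_cases hS : i ∈ S <;> by_cases hT : i ∈ T <;> simp_all

lemma lexLt.not_lexLe {n : ℕ} {a b : Fin n → ℝ} (h : lexLt a b) : ¬ lexLe b a := by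
  obtain ⟨i, hi, hlt⟩ := h
  rintro (rfl | ⟨j, hj, hlt'⟩)
  · exact lt_irrefl _ hlt
  · rcases lt_trichotomy i j with hij | rfl | hij
    · exact hlt.ne' (hj i hij)
    · exact lt_asymm hlt hlt'
    · exact hlt'.ne' (hi j hij)

/-- Removing the coefficient at `T` while leaving all others of size at least `|T|` unchanged
strictly lowers the degree profile. -/
lemma lexLt_degP {N : ℕ} {f g : (Fin N → ℝ) → ℝ} {T : Finset (Fin N)}
    (hf : fCoeff f T ≠ 0) (hg : fCoeff g T = 0)
    (h : ∀ S : Finset (Fin N), T.card ≤ S.card → S ≠ T → fCoeff g S = fCoeff f S) :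
    lexLt (degP N g) (degP N f) := by
  have hT : T.card ≤ N := by simpa using T.card_le_univ
  refine ⟨⟨N - T.card, by omega⟩, fun j hj => ?_, ?_⟩
  · have hj' : (j : ℕ) < N - T.card := hj
    refine Finset.sum_congr rfl fun S hS => ?_
    have hS' : S.card = N - (j : ℕ) := by simpa using hS
    rw [h S (by omega)]
    rintro rfl
    omega
  · refine Finset.sum_lt_sum (fun S hS => ?_) ⟨T, by simp; omega, ?_⟩
    · have hS' : S.card = N - (N - T.card) := by simpa using hS
      by_cases hST : S = T
      · rw [hST, hg, zero_pow two_ne_zero]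
        positivity
      · rw [h S (by omega) hST]
    · rw [hg, zero_pow two_ne_zero]
      positivity

/-- If `f` has a nonzero Fourier coefficient outside the subsets of `[N0]`, then every
min-degree interpolator of `f` on `X_{N0}` disagrees with `f` somewhere on `{-1,1}^N`. -/
theorem minDeg_no_LDHD (N N0 : ℕ) (hN0 : 1 ≤ N0) (hN : N0 ≤ N)
    (f : (Fin N → ℝ) → ℝ)
    (hf : ∃ T : Finset (Fin N), ¬ (∀ i ∈ T, (i : ℕ) < N0) ∧ fCoeff f T ≠ 0)
    (g : (Fin N → ℝ) → ℝ) (hg : MinDegInterpolator N N0 g f) :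
    ∃ σ : Fin N → Bool, g (toVec σ) ≠ f (toVec σ) := by
  by_contra! hfg
  obtain ⟨T, hT, hfT⟩ := hf
  push Not at hT
  obtain ⟨i, hiT, hi⟩ := hT
  have hne : T.erase i ≠ T := fun h => Finset.erase_eq_self.mp h hiT
  have hcard : (T.erase i).card < T.card := Finset.card_erase_lt_of_mem hiT
  refine lexLt.not_lexLe (lexLt_degP (T := T) ?_ ?_ ?_) (hg.2
    (fun x => f x + fCoeff f T * (monomialOn (T.erase i) x - monomialOn T x)) ?_)
  · rwa [fCoeff_congr hfg]
  · simp [fCoeff_add_mul_sub, fCoeff_monomialOn, hne]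
  · intro S hS hST
    have hSe : T.erase i ≠ S := by
      rintro rfl
      omega
    simp [fCoeff_add_mul_sub, fCoeff_monomialOn, hSe, hST.symm, fCoeff_congr hfg]
  · intro σ hσ
    simp [monomialOn, ← Finset.mul_prod_erase T _ hiT, toVec, hσ i hi]

end
end

section
/- Let A* ∈ ℝ^{N×N} be upper triangular and let P ∈ ℝ^{d×N} for some d ≥ 1. Then 2^{-N0} ∑_{x ∈ X_{N0}} (1/2)·(xᵀ (M_N^u ∘ (PᵀP)) e_{n(x)} − xᵀ A* e_{n(x)})² = (1/2)·‖Q_{N0} ∘ (PᵀP − A*)‖_F², where Q_{N0} ∈ ℝ^{N×N} is defined by (Q_{N0})_{ij} = 2^{-(N0 - j + 1)/2} for 1 ≤ i ≤ j ≤ N0 and (Q_{N0})_{ij} = 0 otherwise. -/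
open Finset Matrix

noncomputable section

def cubeLow (N N0 : ℕ) : Finset (Fin N → Bool) :=
  Finset.univ.filter (fun σ => ∀ i : Fin N, N0 ≤ (i : ℕ) → σ i = true)

def nIdx {N : ℕ} (σ : Fin N → Bool) : ℕ :=
  Finset.univ.sup (fun i : Fin N => if σ i then 0 else (i : ℕ) + 1)

def eVec (N : ℕ) (k : ℕ) : Fin N → ℝ := fun i => if (i : ℕ) + 1 = k then 1 else 0

def outer {N : ℕ} (σ : Fin N → Bool) : Matrix (Fin N) (Fin N) ℝ :=
  Matrix.of fun i j => toVec σ i * eVec N (nIdx σ) j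

def frobInner {N : ℕ} (A B : Matrix (Fin N) (Fin N) ℝ) : ℝ :=
  ∑ i, ∑ j, A i j * B i j

def maskU (N : ℕ) : Matrix (Fin N) (Fin N) ℝ :=
  Matrix.of fun i j => if i ≤ j then 1 else 0

def bPLAA {N : ℕ} (i j : Fin N) (σ : Fin N → Bool) : ℝ :=
  (if i = j then -1 else toVec σ i) * ((1 - toVec σ j) / 2) *
    ∏ k ∈ Finset.univ.filter (fun k : Fin N => j < k), (1 + toVec σ k) / 2


/-- The matrix `Q_{N0}` with `(Q_{N0})_{ij} = 2^{-(N0-j+1)/2}` for `1 ≤ i ≤ j ≤ N0`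
(here in 0-based indexing) and `0` otherwise. -/
def Qmat (N N0 : ℕ) : Matrix (Fin N) (Fin N) ℝ :=
  Matrix.of fun i j =>
    if i ≤ j ∧ (j : ℕ) < N0 then (2 : ℝ) ^ (-(((N0 : ℝ) - (j : ℕ)) / 2)) else 0

/-- The sign vectors whose last `-1` is at position `j`. -/
def lastNeg {N : ℕ} (j : Fin N) : Finset (Fin N → Bool) :=
  Fintype.piFinset fun k => if k < j then Finset.univ else if k = j then {false} else {true}

theorem mem_lastNeg {N : ℕ} {j : Fin N} {σ : Fin N → Bool} :
    σ ∈ lastNeg j ↔ σ j = false ∧ ∀ k, j < k → σ k = true := by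
  rw [lastNeg, Fintype.mem_piFinset]
  constructor
  · intro h
    refine ⟨by simpa using h j, fun k hk => ?_⟩
    simpa [hk.not_gt, hk.ne'] using h k
  · rintro ⟨h₁, h₂⟩ k
    rcases lt_trichotomy k j with h | h | h
    · simp [h]
    · simp [h, h₁]
    · simp [h.not_gt, h.ne', h₂ k h]

theorem card_lastNeg {N : ℕ} (j : Fin N) : (lastNeg j).card = 2 ^ (j : ℕ) := by
  have h : ∀ k : Fin N,
      (if k < j then Finset.univ else if k = j then {false} else {true} : Finset Bool).card =
        if k < j then 2 else 1 := by
    intro k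
    split_ifs <;> simp
  rw [lastNeg, Fintype.card_piFinset, Finset.prod_congr rfl fun k _ => h k, Finset.prod_ite]
  simp [Finset.filter_gt_eq_Iio]

theorem nIdx_eq_succ_iff {N : ℕ} (σ : Fin N → Bool) (j : Fin N) :
    (j : ℕ) + 1 = nIdx σ ↔ σ ∈ lastNeg j := by
  rw [mem_lastNeg]
  constructor
  · intro h
    have hle : ∀ k, (if σ k then 0 else (k : ℕ) + 1) ≤ (j : ℕ) + 1 := fun k => by
      rw [h]
      exact Finset.le_sup (f := fun i : Fin N => if σ i then 0 else (i : ℕ) + 1)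
        (Finset.mem_univ k)
    obtain ⟨k, -, hk⟩ := Finset.exists_mem_eq_sup (Finset.univ : Finset (Fin N))
      ⟨j, Finset.mem_univ j⟩ (fun i : Fin N => if σ i then 0 else (i : ℕ) + 1)
    have hk' : (j : ℕ) + 1 = if σ k then 0 else (k : ℕ) + 1 := h.trans hk
    constructor
    · cases hσ : σ k
      · have : j = k := Fin.ext (by simpa [hσ] using hk')
        rwa [this]
      · simp [hσ] at hk'
    · intro l hl
      by_contra hσ
      have := hle l
      rw [if_neg hσ] at this
      have : (j : ℕ) < l := hl
      omega
  · rintro ⟨h₁, h₂⟩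
    apply le_antisymm
    · have := Finset.le_sup (f := fun i : Fin N => if σ i then 0 else (i : ℕ) + 1)
        (Finset.mem_univ j)
      simp only [h₁, Bool.false_eq_true, if_false] at this
      exact this
    · refine Finset.sup_le fun k _ => ?_
      by_cases hk : j < k
      · simp [h₂ k hk]
      · have : (k : ℕ) ≤ j := not_lt.mp hk
        split_ifs <;> omega

theorem toVec_mul_self {N : ℕ} (σ : Fin N → Bool) (i : Fin N) : toVec σ i * toVec σ i = 1 := by
  unfold toVec
  split_ifs <;> norm_num

/-- Coordinates below `j` have zero correlation with every other coordinate on `lastNeg j`. -/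
theorem sum_lastNeg_eq_zero {N : ℕ} {i i' j : Fin N} (hi : i < j) (hne : i ≠ i') :
    ∑ σ ∈ lastNeg j, toVec σ i * toVec σ i' = 0 := by
  refine Finset.sum_involution (fun σ _ => Function.update σ i (!σ i)) ?_ ?_ ?_ ?_
  · intro σ _
    simp only [toVec, Function.update_self, Function.update_of_ne hne.symm]
    cases σ i <;> cases σ i' <;> simp
  · intro σ _ _ h
    simpa using congrFun h i
  · intro σ hσ
    rw [mem_lastNeg] at hσ ⊢
    refine ⟨by rw [Function.update_of_ne hi.ne', hσ.1], fun k hk => ?_⟩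
    rw [Function.update_of_ne (hi.trans hk).ne', hσ.2 k hk]
  · intro σ _
    simp

theorem sum_lastNeg_toVec_mul {N : ℕ} {i i' j : Fin N} (hi : i ≤ j) (hi' : i' ≤ j) :
    ∑ σ ∈ lastNeg j, toVec σ i * toVec σ i' = if i = i' then 2 ^ (j : ℕ) else 0 := by
  split_ifs with h
  · subst h
    simp [toVec_mul_self, card_lastNeg]
  · rcases hi.lt_or_eq with hlt | rfl
    · exact sum_lastNeg_eq_zero hlt h
    · simp_rw [mul_comm (toVec _ i)]
      exact sum_lastNeg_eq_zero (lt_of_le_of_ne hi' (Ne.symm h)) (Ne.symm h)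

theorem sum_lastNeg_sq {N : ℕ} (j : Fin N) (b : Fin N → ℝ) (hb : ∀ i, j < i → b i = 0) :
    ∑ σ ∈ lastNeg j, (∑ i, toVec σ i * b i) ^ 2 = 2 ^ (j : ℕ) * ∑ i, b i ^ 2 := by
  have expand : ∀ σ : Fin N → Bool, (∑ i, toVec σ i * b i) ^ 2 =
      ∑ i, ∑ i', b i * b i' * (toVec σ i * toVec σ i') := fun σ => by
    rw [sq, Finset.sum_mul_sum]
    exact Finset.sum_congr rfl fun i _ => Finset.sum_congr rfl fun i' _ => by ring
  simp_rw [expand]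
  rw [Finset.sum_comm, Finset.mul_sum]
  refine Finset.sum_congr rfl fun i _ => ?_
  rw [Finset.sum_comm]
  have inner : ∀ i', ∑ σ ∈ lastNeg j, b i * b i' * (toVec σ i * toVec σ i') =
      if i = i' then 2 ^ (j : ℕ) * b i ^ 2 else 0 := fun i' => by
    rw [← Finset.mul_sum]
    by_cases hi : j < i
    · simp [hb i hi]
    by_cases hi' : j < i'
    · have : i ≠ i' := fun h => hi (h ▸ hi')
      simp [hb i' hi', this]
    rw [sum_lastNeg_toVec_mul (not_lt.mp hi) (not_lt.mp hi')]
    split_ifs with h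
    · subst h
      ring
    · simp
  simp [inner]

theorem filter_cubeLow_lastNeg {N : ℕ} (N0 : ℕ) (j : Fin N) :
    (cubeLow N N0).filter (· ∈ lastNeg j) = if (j : ℕ) < N0 then lastNeg j else ∅ := by
  ext σ
  simp only [Finset.mem_filter, cubeLow, Finset.mem_univ, true_and]
  split_ifs with h
  · refine ⟨And.right, fun hσ => ⟨fun i hi => (mem_lastNeg.mp hσ).2 i ?_, hσ⟩⟩
    exact Fin.lt_def.mpr (h.trans_le hi)
  · simp only [Finset.notMem_empty, iff_false, not_and]
    intro hσ hmem
    simpa [(mem_lastNeg.mp hmem).1] using hσ j (not_lt.mp h)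

theorem dotProduct_mulVec_eVec_sq {N : ℕ} (B : Matrix (Fin N) (Fin N) ℝ) (σ : Fin N → Bool) :
    (toVec σ ⬝ᵥ B.mulVec (eVec N (nIdx σ))) ^ 2 =
      ∑ j, if σ ∈ lastNeg j then (∑ i, toVec σ i * B i j) ^ 2 else 0 := by
  have he : ∀ j, eVec N (nIdx σ) j = if σ ∈ lastNeg j then 1 else 0 := fun j => by
    simp only [eVec, nIdx_eq_succ_iff]
  simp only [dotProduct, mulVec, he]
  by_cases h : ∃ j, σ ∈ lastNeg j
  · obtain ⟨j, hj⟩ := h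
    have hiff : ∀ k, σ ∈ lastNeg k ↔ k = j := fun k => by
      refine ⟨fun hk => Fin.ext ?_, fun hk => hk ▸ hj⟩
      have h₁ := (nIdx_eq_succ_iff σ k).mpr hk
      have h₂ := (nIdx_eq_succ_iff σ j).mpr hj
      omega
    simp [hiff]
  · push Not at h
    simp [h]

theorem sum_cubeLow_sq {N : ℕ} (N0 : ℕ) (B : Matrix (Fin N) (Fin N) ℝ)
    (hB : ∀ i j, j < i → B i j = 0) :
    ∑ σ ∈ cubeLow N N0, (toVec σ ⬝ᵥ B.mulVec (eVec N (nIdx σ))) ^ 2 =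
      ∑ j : Fin N, if (j : ℕ) < N0 then 2 ^ (j : ℕ) * ∑ i, B i j ^ 2 else 0 := by
  simp_rw [dotProduct_mulVec_eVec_sq]
  rw [Finset.sum_comm]
  refine Finset.sum_congr rfl fun j _ => ?_
  rw [← Finset.sum_filter, filter_cubeLow_lastNeg]
  split_ifs
  · exact sum_lastNeg_sq j (fun i => B i j) fun i hi => hB i j hi
  · simp

theorem Qmat_sq {N : ℕ} (N0 : ℕ) (i j : Fin N) :
    Qmat N N0 i j ^ 2 = if i ≤ j ∧ (j : ℕ) < N0 then 1 / 2 ^ N0 * 2 ^ (j : ℕ) else 0 := by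
  simp only [Qmat, Matrix.of_apply]
  split_ifs
  · rw [← Real.rpow_natCast, ← Real.rpow_mul (by norm_num)]
    have : -(((N0 : ℝ) - (j : ℕ)) / 2) * ((2 : ℕ) : ℝ) = (j : ℕ) - (N0 : ℝ) := by
      push_cast
      ring
    rw [this, Real.rpow_sub (by norm_num), Real.rpow_natCast, Real.rpow_natCast]
    ring
  · simp

/-- The population `ℓ2` loss of PLAA with APE over `X_{N0}` equals
`(1/2)‖Q_{N0} ∘ (PᵀP − A*)‖_F²`. -/
theorem plaa_ape_loss (N N0 : ℕ) (hN0 : 1 ≤ N0) (hN : N0 ≤ N)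
    (d : ℕ) (hd : 1 ≤ d)
    (Astar : Matrix (Fin N) (Fin N) ℝ) (hA : ∀ i j : Fin N, j < i → Astar i j = 0)
    (P : Matrix (Fin d) (Fin N) ℝ) :
    (1 / 2 ^ N0 : ℝ) *
        ∑ σ ∈ cubeLow N N0,
          (1 / 2) *
            (toVec σ ⬝ᵥ
                (Matrix.of fun i j => maskU N i j * (Pᵀ * P) i j).mulVec (eVec N (nIdx σ)) -
              toVec σ ⬝ᵥ Astar.mulVec (eVec N (nIdx σ))) ^ 2 =
      (1 / 2) * ∑ i, ∑ j, (Qmat N N0 i j * ((Pᵀ * P) i j - Astar i j)) ^ 2 := by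
  set B : Matrix (Fin N) (Fin N) ℝ :=
    (Matrix.of fun i j => maskU N i j * (Pᵀ * P) i j) - Astar with hBdef
  have hB : ∀ i j, j < i → B i j = 0 := fun i j h => by
    simp [hBdef, maskU, h.not_ge, hA i j h]
  have hB' : ∀ i j, i ≤ j → B i j = (Pᵀ * P) i j - Astar i j := fun i j h => by
    simp [hBdef, maskU, h]
  simp_rw [← dotProduct_sub, ← Matrix.sub_mulVec]
  rw [← Finset.mul_sum, sum_cubeLow_sq N0 B hB, mul_left_comm, Finset.mul_sum, Finset.sum_comm]
  congr 1
  refine Finset.sum_congr rfl fun j _ => ?_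
  split_ifs with hj
  · rw [Finset.mul_sum, Finset.mul_sum]
    refine Finset.sum_congr rfl fun i _ => ?_
    rw [mul_pow, Qmat_sq]
    by_cases hij : i ≤ j
    · rw [if_pos ⟨hij, hj⟩, hB' i j hij]
      ring
    · simp [hij, hB i j (not_le.mp hij)]
  · simp [mul_pow, Qmat_sq, hj]

end
end

section
/- Let U_1, …, U_r be a GRPE family, b_k(x) = ⟨x e_{n(x)}ᵀ, U_k⟩, and let c ∈ ℝ^r define the concept c(x) = ∑_{k=1}^r c_k·b_k(x). Define p̂ ∈ ℝ^r by p̂_k = c_k if (U_k)_{ij} ≠ 0 for some 1 ≤ i ≤ j ≤ N0, and p̂_k = 0 otherwise. Then (i) ∑_{k=1}^r p̂_k·b_k(x) = c(x) for all x ∈ X_{N0}; and (ii) for every p' ∈ ℝ^r with ∑_{k=1}^r p'_k·b_k(x) = c(x) for all x ∈ X_{N0}, one has p̂_k² ≤ p'_k² for all k = 1, …, r. -/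
open Finset Matrix

noncomputable section

/-- A GRPE family: upper triangular matrices of unit Frobenius norm with disjoint supports. -/
def GRPEFamily (N r : ℕ) (U : Fin r → Matrix (Fin N) (Fin N) ℝ) : Prop :=
  (∀ m : Fin r, ∀ i j : Fin N, j < i → U m i j = 0) ∧
  (∀ m : Fin r, frobInner (U m) (U m) = 1) ∧
  (∀ m m' : Fin r, m ≠ m' → ∀ i j : Fin N, U m i j * U m' i j = 0)

/-- `b_k(x) = ⟨x e_{n(x)}ᵀ, U_k⟩`. -/
def bfun {N r : ℕ} (U : Fin r → Matrix (Fin N) (Fin N) ℝ) (k : Fin r)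
    (σ : Fin N → Bool) : ℝ :=
  frobInner (outer σ) (U k)

/-- The Frobenius pairing with `outer σ` only sees the column of `A` indexed by `nIdx σ`. -/
theorem frobInner_outer {N : ℕ} {σ : Fin N → Bool} {j : Fin N} (hσ : nIdx σ = (j : ℕ) + 1)
    (A : Matrix (Fin N) (Fin N) ℝ) :
    frobInner (outer σ) A = ∑ i, toVec σ i * A i j := by
  unfold frobInner
  refine Finset.sum_congr rfl fun i _ => ?_
  rw [Finset.sum_eq_single j]
  · simp [outer, eVec, hσ]
  · intro l _ hl
    have : (l : ℕ) ≠ j := fun h => hl (Fin.ext h)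
    simp [outer, eVec, hσ, this]
  · simp

theorem sum_mul_bfun {N r : ℕ} (U : Fin r → Matrix (Fin N) (Fin N) ℝ) (d : Fin r → ℝ)
    (σ : Fin N → Bool) :
    ∑ k, d k * bfun U k σ = frobInner (outer σ) (∑ k, d k • U k) := by
  simp only [bfun, frobInner, Matrix.sum_apply, Matrix.smul_apply, smul_eq_mul, Finset.mul_sum]
  rw [Finset.sum_comm]
  refine Finset.sum_congr rfl fun i _ => ?_
  rw [Finset.sum_comm]
  refine Finset.sum_congr rfl fun j _ => Finset.sum_congr rfl fun k _ => ?_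
  ring

theorem nIdx_le_of_mem_cubeLow {N N0 : ℕ} {σ : Fin N → Bool} (hσ : σ ∈ cubeLow N N0) :
    nIdx σ ≤ N0 := by
  refine Finset.sup_le fun i _ => ?_
  simp only [cubeLow, Finset.mem_filter, Finset.mem_univ, true_and] at hσ
  split_ifs with h
  · exact Nat.zero_le _
  · by_contra hlt
    exact h (hσ i (by omega))

theorem bfun_eq_zero_of_mem_cubeLow {N N0 r : ℕ} {U : Fin r → Matrix (Fin N) (Fin N) ℝ}
    {k : Fin r} (hU : ∀ i j : Fin N, (j : ℕ) < N0 → U k i j = 0)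
    {σ : Fin N → Bool} (hσ : σ ∈ cubeLow N N0) : bfun U k σ = 0 := by
  unfold bfun frobInner
  refine Finset.sum_eq_zero fun i _ => Finset.sum_eq_zero fun j _ => ?_
  have hn := nIdx_le_of_mem_cubeLow hσ
  by_cases hj : (j : ℕ) < N0
  · rw [hU i j hj, mul_zero]
  · have : (j : ℕ) + 1 ≠ nIdx σ := by omega
    simp [outer, eVec, this]

/-- The cube point whose entries equal to `-1` are exactly those at `i` and `j`. -/
def negAt {N : ℕ} (i j : Fin N) : Fin N → Bool := fun k => decide (k ≠ i ∧ k ≠ j)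

theorem nIdx_negAt {N : ℕ} {i j : Fin N} (hij : i ≤ j) : nIdx (negAt i j) = (j : ℕ) + 1 := by
  apply le_antisymm
  · refine Finset.sup_le fun k _ => ?_
    split_ifs with h
    · exact Nat.zero_le _
    · have : k = i ∨ k = j := by
        simp only [negAt, decide_eq_true_eq] at h
        tauto
      rcases this with rfl | rfl
      · exact Nat.succ_le_succ hij
      · exact le_rfl
  · refine le_trans ?_ (Finset.le_sup (f := fun k : Fin N =>
      if negAt i j k then 0 else (k : ℕ) + 1) (Finset.mem_univ j))
    simp [negAt]

theorem negAt_mem_cubeLow {N N0 : ℕ} {i j : Fin N} (hij : i ≤ j) (hj : (j : ℕ) < N0) :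
    negAt i j ∈ cubeLow N N0 := by
  simp only [cubeLow, Finset.mem_filter, Finset.mem_univ, true_and, negAt, decide_eq_true_eq]
  have hij' : (i : ℕ) ≤ j := hij
  refine fun k hk => ⟨?_, ?_⟩ <;> rintro rfl <;> omega

/-- An upper triangular matrix orthogonal to `outer σ` for every `σ ∈ cubeLow N N0` vanishes on
its first `N0` columns. -/
theorem apply_eq_zero_of_frobInner_outer_eq_zero {N N0 : ℕ} {A : Matrix (Fin N) (Fin N) ℝ}
    (hA : ∀ i j : Fin N, j < i → A i j = 0)
    (h : ∀ σ ∈ cubeLow N N0, frobInner (outer σ) A = 0) {i j : Fin N} (hj : (j : ℕ) < N0) :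
    A i j = 0 := by
  have column : ∀ i ≤ j, ∑ k, toVec (negAt i j) k * A k j = 0 := fun i hi => by
    rw [← frobInner_outer (nIdx_negAt hi), h _ (negAt_mem_cubeLow hi hj)]
  have above : ∀ i < j, A i j = 0 := fun i hi => by
    have hdiff : ∑ k, (toVec (negAt j j) k - toVec (negAt i j) k) * A k j = 0 := by
      simp only [sub_mul, Finset.sum_sub_distrib, column j le_rfl, column i hi.le, sub_zero]
    rw [Finset.sum_eq_single i] at hdiff
    · norm_num [toVec, negAt, hi.ne] at hdiff
      exact hdiff
    · intro k _ hk
      simp [toVec, negAt, hk]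
    · simp
  rcases lt_trichotomy i j with hi | rfl | hi
  · exact above i hi
  · have hsum := column i le_rfl
    rw [Finset.sum_eq_single i] at hsum
    · simpa [toVec, negAt] using hsum
    · intro k _ hk
      rcases lt_or_gt_of_ne hk with hk | hk
      · rw [above k hk, mul_zero]
      · rw [hA k i hk, mul_zero]
    · simp
  · exact hA i j hi

open scoped Classical in
/-- The coordinatewise truncation `p̂` of the target coefficients interpolates the concept
on `X_{N0}` and is coordinatewise minimal in absolute value among all interpolators. -/
theorem grpe_truncation_min (N N0 r : ℕ) (hN0 : 1 ≤ N0) (hN : N0 ≤ N)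
    (U : Fin r → Matrix (Fin N) (Fin N) ℝ) (hU : GRPEFamily N r U)
    (c : Fin r → ℝ) :
    (∀ σ ∈ cubeLow N N0,
        (∑ k, (if ∃ i j : Fin N, i ≤ j ∧ (j : ℕ) < N0 ∧ U k i j ≠ 0 then c k else 0) *
            bfun U k σ) =
          ∑ k, c k * bfun U k σ) ∧
    (∀ p' : Fin r → ℝ,
      (∀ σ ∈ cubeLow N N0, (∑ k, p' k * bfun U k σ) = ∑ k, c k * bfun U k σ) →
      ∀ k : Fin r,
        (if ∃ i j : Fin N, i ≤ j ∧ (j : ℕ) < N0 ∧ U k i j ≠ 0 then c k else 0) ^ 2 ≤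
          (p' k) ^ 2) := by
  obtain ⟨htri, -, hdisj⟩ := hU
  refine ⟨fun σ hσ => Finset.sum_congr rfl fun k _ => ?_, fun p' hp' k => ?_⟩
  · split_ifs with hk
    · rfl
    · push Not at hk
      rw [bfun_eq_zero_of_mem_cubeLow (fun i j hj => ?_) hσ, mul_zero, mul_zero]
      rcases le_or_gt i j with hij | hij
      · exact hk i j hij hj
      · exact htri k i j hij
  · split_ifs with hk
    · obtain ⟨i, j, -, hj, hne⟩ := hk
      have hzero : (∑ m, (p' m - c m) • U m) i j = 0 := by
        refine apply_eq_zero_of_frobInner_outer_eq_zero (fun a b hab => ?_) (fun σ hσ => ?_) hj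
        · simp [Matrix.sum_apply, htri _ a b hab]
        · rw [← sum_mul_bfun]
          simp only [sub_mul, Finset.sum_sub_distrib, hp' σ hσ, sub_self]
      rw [Matrix.sum_apply, Finset.sum_eq_single k] at hzero
      · have hpc : p' k - c k = 0 := (mul_eq_zero.mp hzero).resolve_right hne
        rw [sub_eq_zero.mp hpc]
      · intro m _ hm
        have : U m i j = 0 := (mul_eq_zero.mp (hdisj m k hm i j)).resolve_right hne
        simp [this]
      · simp
    · simpa using sq_nonneg (p' k)

end
end
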